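/- (Weighted interpolation inequality) Let 1 < p < q < 3p < ∞ and k ≥ 3, and set m = (2kp − (k−3)(3q−3p))/(3p−q). Then there is a constant C = C(k,p,q) such that for every nonnegative Schwartz function f : ℝ³ → [0,∞): ∫_{ℝ³} ⟨v⟩^k f(v)^q dv ≤ C ( ∫_{ℝ³} ⟨v⟩^m f(v)^p dv )^{(3p−q)/(2p)} ( ∫_{ℝ³} ⟨v⟩^{k−3} |∇(f^{p/2})(v)|² dv )^{3(q−p)/(2p)}. -/

import Mathlib

open MeasureTheory Real
noncomputable section

/-- Velocity space `ℝ³`. -/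
abbrev V3 : Type := EuclideanSpace ℝ (Fin 3)

/-- Japanese bracket `⟨v⟩ = (1 + |v|²)^{1/2}`. -/
def jap (v : V3) : ℝ := Real.sqrt (1 + ‖v‖ ^ 2)

/-- Positive part `x₊ = max(x,0)`. -/
def plus (x : ℝ) : ℝ := max x 0

/-- Partial derivative in the `i`-th coordinate direction. -/
def pd (i : Fin 3) (F : V3 → ℝ) (v : V3) : ℝ :=
  fderiv ℝ F v (EuclideanSpace.single i 1)

/-- The Landau-Coulomb diffusion matrix `A[g]`. -/
def Amat (g : V3 → ℝ) (v : V3) : Matrix (Fin 3) (Fin 3) ℝ := fun i j =>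
  ∫ w : V3, g w * (((if i = j then (1 : ℝ) else 0) -
      (v - w) i * (v - w) j / ‖v - w‖ ^ 2) / (8 * π * ‖v - w‖))

/-- The Coulomb potential `a[g]`. -/
def apot (g : V3 → ℝ) (v : V3) : ℝ := ∫ w : V3, g w / (4 * π * ‖v - w‖)

/-- Right-hand side `∇·(A[g]∇g − ∇a[g] g)` of the Landau equation. -/
def landauRHS (g : V3 → ℝ) (v : V3) : ℝ :=
  ∑ i : Fin 3, pd i (fun u =>
    (∑ j : Fin 3, Amat g u i j * pd j g u) - pd i (apot g) u * g u) v

/-- `f` solves the Landau equation pointwise at every time in `s`. -/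
def SolvesLandauOn (s : Set ℝ) (f : ℝ → V3 → ℝ) : Prop :=
  ∀ t ∈ s, ∀ v : V3, HasDerivAt (fun τ => f τ v) (landauRHS (f t) v) t

/-- A smooth, rapidly decaying (Schwartz-class in `v`) nonnegative solution on the
time set `s`, solving the equation pointwise on the interior of `s`. -/
structure SmoothRapidSolutionOn (s : Set ℝ) (f : ℝ → V3 → ℝ) : Prop where
  nonneg : ∀ t ∈ s, ∀ v : V3, 0 ≤ f t v
  smooth : ContDiffOn ℝ (⊤ : ℕ∞) (fun q : ℝ × V3 => f q.1 q.2) (s ×ˢ (Set.univ : Set V3))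
  schwartz : ∀ t ∈ s, ∃ φ : SchwartzMap V3 ℝ, ∀ v, f t v = φ v
  solves : SolvesLandauOn (interior s) f

/-- Normalization: unit mass, zero mean velocity, temperature `3`. -/
def Normalized (g : V3 → ℝ) : Prop :=
  (∫ v : V3, g v) = 1 ∧ (∀ i : Fin 3, (∫ v : V3, v i * g v) = 0) ∧
    (∫ v : V3, ‖v‖ ^ 2 * g v) = 3

/-- `c • Id ≤ M` as quadratic forms. -/
def matGE (c : ℝ) (M : Matrix (Fin 3) (Fin 3) ℝ) : Prop :=
  ∀ ξ : Fin 3 → ℝ, c * ∑ i, ξ i ^ 2 ≤ ∑ i, ∑ j, M i j * ξ i * ξ j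

/-- `M ≤ c • Id` as quadratic forms. -/
def matLE (M : Matrix (Fin 3) (Fin 3) ℝ) (c : ℝ) : Prop :=
  ∀ ξ : Fin 3 → ℝ, (∑ i, ∑ j, M i j * ξ i * ξ j) ≤ c * ∑ i, ξ i ^ 2

/-- `‖A[g]‖_{L^∞}`: sup over `v` of the operator norm of `A[g](v)`. -/
def AinfNorm (g : V3 → ℝ) : ℝ :=
  ⨆ v : V3, ‖Matrix.toEuclideanCLM (𝕜 := ℝ) (Amat g v)‖

/-- Fisher information (with the convention `x/0 = 0`). -/
def fisher (g : V3 → ℝ) : ℝ := ∫ v : V3, ‖gradient g v‖ ^ 2 / g v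


namespace WII

lemma one_le_jap (v : V3) : 1 ≤ jap v := by
  unfold jap
  rw [Real.one_le_sqrt]
  nlinarith [sq_nonneg ‖v‖]

lemma jap_pos (v : V3) : 0 < jap v := lt_of_lt_of_le one_pos (one_le_jap v)

lemma jap_sq (v : V3) : jap v ^ 2 = 1 + ‖v‖ ^ 2 := by
  unfold jap
  rw [Real.sq_sqrt (by positivity)]

lemma norm_le_jap (v : V3) : ‖v‖ ≤ jap v := by
  apply abs_le_of_sq_le_sq' _ (jap_pos v).le |>.2
  rw [jap_sq]; linarith

lemma jap_le (v : V3) : jap v ≤ 1 + ‖v‖ := by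
  apply abs_le_of_sq_le_sq' _ (by positivity) |>.2
  rw [jap_sq]; nlinarith [norm_nonneg v]

lemma jap_rpow (v : V3) (r : ℝ) : jap v ^ r = (1 + ‖v‖ ^ 2) ^ (r / 2) := by
  unfold jap
  rw [Real.sqrt_eq_rpow, ← Real.rpow_mul (by positivity)]
  congr 1; ring

lemma jap_rpow_pos (v : V3) (r : ℝ) : 0 < jap v ^ r := Real.rpow_pos_of_pos (jap_pos v) r

lemma contDiff_jap_rpow (r : ℝ) : ContDiff ℝ 1 (fun v => jap v ^ r) := by
  simp_rw [jap_rpow]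
  apply ContDiff.rpow_const_of_ne
  · exact contDiff_const.add (contDiff_norm_sq ℝ)
  · intro x; positivity

lemma continuous_jap_rpow (r : ℝ) : Continuous (fun v => jap v ^ r) :=
  (contDiff_jap_rpow r).continuous

lemma hasFDerivAt_jap_rpow (r : ℝ) (v : V3) :
    HasFDerivAt (fun v => jap v ^ r) ((r * jap v ^ (r - 2)) • innerSL ℝ v) v := by
  simp_rw [jap_rpow]
  have h := ((hasStrictFDerivAt_norm_sq v).hasFDerivAt.const_add (1:ℝ)).rpow_const
    (p := r / 2) (Or.inl (by positivity))
  refine h.congr_fderiv ?_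
  rw [show (r - 2) / 2 = r / 2 - 1 by ring, ← Nat.cast_smul_eq_nsmul ℝ, smul_smul]
  congr 1
  push_cast; ring

lemma integrable_jap_neg : Integrable (fun v : V3 => jap v ^ (-4 : ℝ)) := by
  simp_rw [jap_rpow]
  exact integrable_rpow_neg_one_add_norm_sq (by simp; norm_num)

/-- rapid decay of powers of a nonnegative Schwartz function -/
lemma schwartz_decay (f : SchwartzMap V3 ℝ) (hf : ∀ v, 0 ≤ f v) (s r : ℝ) (hs : 0 < s) :
    ∃ C : ℝ, 0 ≤ C ∧ ∀ v, jap v ^ r * f v ^ s ≤ C * jap v ^ (-4 : ℝ) := by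
  obtain ⟨N, hN⟩ := exists_nat_ge ((r + 4) / s)
  have h0 := fun x => SchwartzMap.one_add_le_sup_seminorm_apply (𝕜 := ℝ) (m := (N, 0)) (k := N) (n := 0)
    le_rfl le_rfl f x
  set D : ℝ := 2 ^ (N, 0).1 * ((Finset.Iic (N, 0)).sup
    fun m => SchwartzMap.seminorm ℝ m.1 m.2) f with hD
  have h1 : ∀ v, jap v ^ (N : ℝ) * f v ≤ D := by
    intro v
    refine le_trans ?_ (h0 v)
    rw [norm_iteratedFDeriv_zero, Real.norm_eq_abs, abs_of_nonneg (hf v), Real.rpow_natCast]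
    gcongr
    · exact hf v
    · exact (jap_pos v).le
    · exact jap_le v
  have hD0 : 0 ≤ D := le_trans (mul_nonneg (jap_rpow_pos 0 _).le (hf 0)) (h1 0)
  refine ⟨D ^ s, by positivity, fun v => ?_⟩
  have h2 : (jap v ^ (N : ℝ) * f v) ^ s ≤ D ^ s :=
    Real.rpow_le_rpow (mul_nonneg (jap_rpow_pos v _).le (hf v)) (h1 v) hs.le
  rw [Real.mul_rpow (jap_rpow_pos v _).le (hf v), ← Real.rpow_mul (jap_pos v).le] at h2
  have h3 : jap v ^ (r + 4) ≤ jap v ^ (N * s) :=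
    Real.rpow_le_rpow_of_exponent_le (one_le_jap v) (by rwa [div_le_iff₀ hs] at hN)
  have h4 : jap v ^ r = jap v ^ (r + 4) * jap v ^ (-4 : ℝ) := by
    rw [← Real.rpow_add (jap_pos v)]; congr 1; ring
  have h5 : 0 ≤ f v ^ s := Real.rpow_nonneg (hf v) s
  have h6 := jap_rpow_pos v (-4)
  calc jap v ^ r * f v ^ s = (jap v ^ (r + 4) * f v ^ s) * jap v ^ (-4 : ℝ) := by rw [h4]; ring
    _ ≤ (jap v ^ (N * s) * f v ^ s) * jap v ^ (-4 : ℝ) := by gcongr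
    _ ≤ _ := by gcongr

lemma integrable_jap_schwartz (f : SchwartzMap V3 ℝ) (hf : ∀ v, 0 ≤ f v) (s r : ℝ) (hs : 0 < s) :
    Integrable (fun v => jap v ^ r * f v ^ s) := by
  obtain ⟨C, hC, h⟩ := schwartz_decay f hf s r hs
  refine (integrable_jap_neg.const_mul C).mono' ?_ (ae_of_all _ fun v => ?_)
  · exact ((continuous_jap_rpow r).mul (f.continuous.rpow_const fun _ => Or.inr hs.le)).aestronglyMeasurable
  · rw [Real.norm_eq_abs, abs_of_nonneg (mul_nonneg (jap_rpow_pos v _).le (Real.rpow_nonneg (hf v) _))]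
    exact h v

lemma schwartz_taylor (f : SchwartzMap V3 ℝ) :
    ∃ M : ℝ, 0 < M ∧ ∀ x y, |f y - f x - fderiv ℝ f x (y - x)| ≤ M * ‖y - x‖ ^ 2 := by
  let F := SchwartzMap.fderivCLM ℝ V3 ℝ f
  obtain ⟨M, hM, h⟩ := F.decay 0 1
  have hF : ∀ x, ‖fderiv ℝ F x‖ ≤ M := fun x => by
    have := h x
    rwa [pow_zero, one_mul, norm_iteratedFDeriv_one] at this
  refine ⟨M, hM, fun x y => ?_⟩
  have hL : ∀ z, ‖fderiv ℝ f z - fderiv ℝ f x‖ ≤ M * ‖z - x‖ := fun z =>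
    convex_univ.norm_image_sub_le_of_norm_fderiv_le (f := F) (𝕜 := ℝ)
      (fun x _ => F.differentiableAt) (fun x _ => hF x) (Set.mem_univ x) (Set.mem_univ z)
  have := (convex_closedBall x ‖y - x‖).norm_image_sub_le_of_norm_fderiv_le' (f := f) (𝕜 := ℝ)
    (φ := fderiv ℝ f x) (C := M * ‖y - x‖) (fun x _ => f.differentiableAt)
    (fun z hz => (hL z).trans (by
      rw [mem_closedBall_iff_norm] at hz
      gcongr)) (Metric.mem_closedBall_self (norm_nonneg _)) (y := y) (by rw [mem_closedBall_iff_norm])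
  rw [Real.norm_eq_abs] at this
  linarith [this, show M * ‖y - x‖ * ‖y - x‖ = M * ‖y - x‖ ^ 2 by ring]

lemma schwartz_grad_sq (f : SchwartzMap V3 ℝ) (hf : ∀ v, 0 ≤ f v) {M : ℝ} (hM : 0 < M)
    (hT : ∀ x y, |f y - f x - fderiv ℝ f x (y - x)| ≤ M * ‖y - x‖ ^ 2) (x : V3) :
    ‖fderiv ℝ f x‖ ≤ 2 * Real.sqrt M * Real.sqrt (f x) := by
  apply ContinuousLinearMap.opNorm_le_bound _ (by positivity)
  intro w
  have hq : ∀ t : ℝ, 0 ≤ (M * ‖w‖ ^ 2) * (t * t) + (fderiv ℝ f x w) * t + f x := by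
    intro t
    have h1 := hT x (x + t • w)
    rw [add_sub_cancel_left, map_smul, norm_smul, smul_eq_mul, mul_pow, Real.norm_eq_abs, sq_abs] at h1
    have h2 := (abs_le.1 h1).2
    have h3 := hf (x + t • w)
    nlinarith
  have hd := discrim_le_zero hq
  unfold discrim at hd
  rw [Real.norm_eq_abs]
  apply abs_le_of_sq_le_sq _ (by positivity)
  rw [mul_pow, mul_pow, mul_pow, Real.sq_sqrt hM.le, Real.sq_sqrt (hf x)]
  nlinarith

/-- The derivative of `f ^ s`. -/
lemma hasFDerivAt_rpow (f : SchwartzMap V3 ℝ) (hf : ∀ v, 0 ≤ f v) (s : ℝ) (hs : 1 / 2 < s) (x : V3) :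
    HasFDerivAt (fun v => f v ^ s) ((s * f x ^ (s - 1)) • fderiv ℝ f x) x := by
  obtain ⟨M, hM, hT⟩ := schwartz_taylor f
  by_cases h0 : f x = 0
  · have hg := schwartz_grad_sq f hf hM hT x
    rw [h0, Real.sqrt_zero, mul_zero, norm_le_zero_iff] at hg
    rw [hg, smul_zero, hasFDerivAt_iff_isLittleO]
    have hb : ∀ y, ‖f y ^ s - f x ^ s - (0 : V3 →L[ℝ] ℝ) (y - x)‖ ≤
        M ^ s * ‖‖y - x‖ ^ (2 * s)‖ := by
      intro y
      have h1 := hT x y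
      rw [hg, h0] at h1
      simp only [_root_.zero_apply, sub_zero] at h1 ⊢
      rw [h0, Real.zero_rpow (by linarith), sub_zero, Real.norm_eq_abs, Real.norm_eq_abs,
        abs_of_nonneg (Real.rpow_nonneg (hf y) s), abs_of_nonneg (by positivity)]
      rw [abs_of_nonneg (hf y)] at h1
      calc f y ^ s ≤ (M * ‖y - x‖ ^ 2) ^ s := Real.rpow_le_rpow (hf y) h1 (by linarith)
        _ = _ := by
          rw [Real.mul_rpow hM.le (by positivity), ← Real.rpow_natCast, ← Real.rpow_mul (by positivity)]
          norm_num
    refine (Asymptotics.IsBigO.of_bound (M ^ s) (Filter.Eventually.of_forall hb)).trans_isLittleO ?_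
    have h2 : ∀ y, ‖y - x‖ ^ (2 * s) = ‖y - x‖ ^ (2 * s - 1) * ‖y - x‖ := by
      intro y
      by_cases hy : ‖y - x‖ = 0
      · rw [hy, Real.zero_rpow (by linarith), mul_zero]
      · rw [Real.rpow_sub_one hy]; field_simp
    simp_rw [h2]
    have h3 : Filter.Tendsto (fun y => ‖y - x‖ ^ (2 * s - 1)) (nhds x) (nhds 0) := by
      have : Continuous (fun y => ‖y - x‖ ^ (2 * s - 1)) :=
        (continuous_id.sub continuous_const).norm.rpow_const fun _ => Or.inr (by linarith)
      have h := this.tendsto x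
      rwa [sub_self, norm_zero, Real.zero_rpow (by linarith)] at h
    have h4 := ((Asymptotics.isLittleO_one_iff ℝ).2 h3).mul_isBigO
      (Asymptotics.isBigO_refl (fun y => ‖y - x‖) (nhds x))
    simp only [one_mul] at h4
    exact h4.norm_right.congr_right (by simp) |>.of_norm_right
  · exact f.differentiableAt.hasFDerivAt.rpow_const (Or.inl h0)

lemma grad_bound (f : SchwartzMap V3 ℝ) (hf : ∀ v, 0 ≤ f v) (s : ℝ) (hs : 1 / 2 < s) :
    ∃ C : ℝ, 0 ≤ C ∧ ∀ x, ‖fderiv ℝ (fun v => f v ^ s) x‖ ≤ C * f x ^ (s - 1 / 2) := by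
  obtain ⟨M, hM, hT⟩ := schwartz_taylor f
  refine ⟨s * (2 * Real.sqrt M), by positivity, fun x => ?_⟩
  rw [(hasFDerivAt_rpow f hf s hs x).fderiv, norm_smul, Real.norm_eq_abs,
    abs_of_nonneg (mul_nonneg (by linarith) (Real.rpow_nonneg (hf x) _))]
  have hg := schwartz_grad_sq f hf hM hT x
  by_cases h0 : f x = 0
  · rw [h0, Real.sqrt_zero, mul_zero] at hg
    have : ‖fderiv ℝ f x‖ = 0 := le_antisymm hg (norm_nonneg _)
    rw [this, mul_zero, h0]
    exact mul_nonneg (by positivity) (Real.rpow_nonneg le_rfl _)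
  · have hp : 0 < f x := lt_of_le_of_ne (hf x) (Ne.symm h0)
    have h1 : f x ^ (s - 1 / 2) = f x ^ (s - 1) * Real.sqrt (f x) := by
      rw [Real.sqrt_eq_rpow, ← Real.rpow_add hp]; congr 1; ring
    rw [h1]
    have := Real.rpow_pos_of_pos hp (s - 1)
    calc s * f x ^ (s - 1) * ‖fderiv ℝ f x‖
        ≤ s * f x ^ (s - 1) * (2 * Real.sqrt M * Real.sqrt (f x)) := by gcongr
      _ = _ := by ring

lemma contDiff_rpow (f : SchwartzMap V3 ℝ) (hf : ∀ v, 0 ≤ f v) (s : ℝ) (hs : 1 / 2 < s) :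
    ContDiff ℝ 1 (fun v => f v ^ s) := by
  rw [contDiff_one_iff_fderiv]
  refine ⟨fun x => (hasFDerivAt_rpow f hf s hs x).differentiableAt, ?_⟩
  rw [continuous_iff_continuousAt]
  intro x
  by_cases h0 : f x = 0
  · obtain ⟨C, hC, hb⟩ := grad_bound f hf s hs
    have hc : Continuous (fun y => C * f y ^ (s - 1 / 2)) :=
      continuous_const.mul (f.continuous.rpow_const fun _ => Or.inr (by linarith))
    have h1 := hc.tendsto x
    simp only [h0] at h1
    rw [Real.zero_rpow (by linarith), mul_zero] at h1
    have h2 := hb x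
    rw [h0, Real.zero_rpow (by linarith), mul_zero, norm_le_zero_iff] at h2
    unfold ContinuousAt
    rw [h2]
    exact squeeze_zero_norm hb h1
  · have : ContDiffAt ℝ 1 (fun v => f v ^ s) x :=
      ((f.smooth 1).contDiffAt).rpow_const_of_ne h0
    exact (this.fderiv_right (m := 0) le_rfl).continuousAt

lemma integrable_grad (f : SchwartzMap V3 ℝ) (hf : ∀ v, 0 ≤ f v) (s r : ℝ) (hs : 1 / 2 < s) :
    Integrable (fun v => jap v ^ r * ‖fderiv ℝ (fun v => f v ^ s) v‖ ^ 2) := by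
  obtain ⟨C, hC, hb⟩ := grad_bound f hf s hs
  refine ((integrable_jap_schwartz f hf (2 * s - 1) r (by linarith)).const_mul (C ^ 2)).mono' ?_
    (ae_of_all _ fun v => ?_)
  · exact ((continuous_jap_rpow r).mul
      (((contDiff_rpow f hf s hs).continuous_fderiv one_ne_zero).norm.pow 2)).aestronglyMeasurable
  · have hj := jap_rpow_pos v r
    rw [Real.norm_eq_abs, abs_of_nonneg (by positivity)]
    have h1 : f v ^ (2 * s - 1) = (f v ^ (s - 1 / 2)) ^ 2 := by
      rw [← Real.rpow_mul_natCast (hf v)]; congr 1; push_cast; ring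
    calc jap v ^ r * ‖fderiv ℝ (fun v => f v ^ s) v‖ ^ 2
        ≤ jap v ^ r * (C * f v ^ (s - 1 / 2)) ^ 2 := by gcongr; exact hb v
      _ = _ := by rw [h1]; ring

lemma euler_integral (w : V3 → ℝ) (hw : ContDiff ℝ 1 w) (hc : HasCompactSupport w) :
    ∫ v, fderiv ℝ w v v = - (3 * ∫ v, w v) := by
  have hwc := hw.continuous
  have hdc : Continuous (fderiv ℝ w) := hw.continuous_fderiv one_ne_zero
  have hi : ∀ i : Fin 3, ∫ v : V3, v i * fderiv ℝ w v (EuclideanSpace.single i 1) = - ∫ v, w v := by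
    intro i
    let L : V3 →L[ℝ] ℝ := EuclideanSpace.proj i
    have hL : ∀ v, fderiv ℝ (fun v : V3 => L v) v (EuclideanSpace.single i 1) = 1 := by
      intro v
      rw [L.hasFDerivAt.fderiv]
      simp [L]
    have h := integral_mul_fderiv_eq_neg_fderiv_mul_of_integrable (μ := (volume : Measure V3))
      (f := fun v => L v) (g := w) (v := EuclideanSpace.single i 1) ?_ ?_ ?_
      (fun x _ => L.differentiableAt) (fun x _ => hw.differentiable one_ne_zero x)
    · simp only [hL, one_mul] at h
      exact h
    · simp only [hL, one_mul]
      exact hwc.integrable_of_hasCompactSupport hc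
    · refine Continuous.integrable_of_hasCompactSupport
        (L.continuous.mul (hdc.clm_apply continuous_const)) ?_
      exact (hc.fderiv_apply (𝕜 := ℝ) _).mul_left
    · exact (L.continuous.mul hwc).integrable_of_hasCompactSupport hc.mul_left
  have hs : ∀ v : V3, fderiv ℝ w v v = ∑ i : Fin 3, v i * fderiv ℝ w v (EuclideanSpace.single i 1) := by
    intro v
    have hv := (EuclideanSpace.basisFun (Fin 3) ℝ).sum_repr v
    generalize fderiv ℝ w v = L
    conv_lhs => rw [← hv]
    rw [map_sum]
    simp
  simp_rw [hs]
  rw [integral_finsetSum]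
  · simp_rw [hi]
    simp
  · intro i _
    refine Continuous.integrable_of_hasCompactSupport
        (((EuclideanSpace.proj i : V3 →L[ℝ] ℝ)).continuous.mul (hdc.clm_apply continuous_const)) ?_
    exact (hc.fderiv_apply (𝕜 := ℝ) _).mul_left

lemma hardy (a : ℝ) (ha : 0 ≤ a) (u : V3 → ℝ) (hu : ContDiff ℝ 1 u) (hc : HasCompactSupport u) :
    ∫ v, jap v ^ (a - 2) * u v ^ 2 ≤ 4 * ∫ v, jap v ^ a * ‖fderiv ℝ u v‖ ^ 2 := by
  have hdc : Continuous (fderiv ℝ u) := hu.continuous_fderiv one_ne_zero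
  have hw : ContDiff ℝ 1 (fun v => jap v ^ (a - 2) * u v ^ 2) :=
    (contDiff_jap_rpow _).mul (hu.pow 2)
  have hc2 : HasCompactSupport (fun v => u v ^ 2) := by
    simp_rw [pow_two]; exact hc.mul_left
  have hwc : HasCompactSupport (fun v => jap v ^ (a - 2) * u v ^ 2) := hc2.mul_left
  have hcd : HasCompactSupport (fun v => ‖fderiv ℝ u v‖ ^ 2) :=
    (hc.fderiv (𝕜 := ℝ)).comp_left (g := fun L => ‖L‖ ^ 2) (by simp)
  have i1 : Integrable (fun v => jap v ^ (a - 2) * u v ^ 2) :=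
    hw.continuous.integrable_of_hasCompactSupport hwc
  have i2 : Integrable (fun v => jap v ^ a * ‖fderiv ℝ u v‖ ^ 2) :=
    ((continuous_jap_rpow a).mul (hdc.norm.pow 2)).integrable_of_hasCompactSupport hcd.mul_left
  have i3 : Integrable (fun v => fderiv ℝ (fun v => jap v ^ (a - 2) * u v ^ 2) v v) := by
    refine ((hw.continuous_fderiv one_ne_zero).clm_apply continuous_id).integrable_of_hasCompactSupport ?_
    refine HasCompactSupport.mono (hwc.fderiv (𝕜 := ℝ)) ?_
    intro v hv h
    apply hv
    simp [h]
  have he := euler_integral _ hw hwc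
  have hpt : ∀ v, jap v ^ (a - 2) * u v ^ 2 ≤ 3 * (jap v ^ (a - 2) * u v ^ 2) +
      fderiv ℝ (fun v => jap v ^ (a - 2) * u v ^ 2) v v +
      (1 / 2 * (jap v ^ (a - 2) * u v ^ 2) + 2 * (jap v ^ a * ‖fderiv ℝ u v‖ ^ 2)) := by
    intro v
    have hd := (hasFDerivAt_jap_rpow (a - 2) v).mul ((hu.differentiable one_ne_zero v).hasFDerivAt.pow 2)
    have hd' : fderiv ℝ (fun v => jap v ^ (a - 2) * u v ^ 2) v v =
        jap v ^ (a - 2) * (2 * u v * fderiv ℝ u v v) +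
        u v ^ 2 * ((a - 2) * jap v ^ (a - 2 - 2) * ‖v‖ ^ 2) := by
      have hd2 : fderiv ℝ (fun v => jap v ^ (a - 2) * u v ^ 2) v = _ := HasFDerivAt.fderiv hd
      rw [hd2]
      simp [real_inner_self_eq_norm_sq]
    rw [hd']
    have hj := jap_pos v
    have e1 : jap v ^ (a - 2) = jap v ^ (a - 2 - 2) * jap v ^ 2 := by
      rw [← Real.rpow_natCast, ← Real.rpow_add hj]; congr 1; push_cast; ring
    have e2 : jap v ^ a = jap v ^ (a - 2) * jap v ^ 2 := by
      rw [← Real.rpow_natCast, ← Real.rpow_add hj]; congr 1; push_cast; ring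
    have hJ := jap_rpow_pos v (a - 2 - 2)
    have hJ2 := jap_rpow_pos v (a - 2)
    have k1 : 0 ≤ 2 * jap v ^ (a - 2) + (a - 2) * jap v ^ (a - 2 - 2) * ‖v‖ ^ 2 := by
      rw [e1, jap_sq]
      have : 0 ≤ jap v ^ (a - 2 - 2) * (2 + a * ‖v‖ ^ 2) := by positivity
      nlinarith
    have k2 : |fderiv ℝ u v v| ≤ ‖fderiv ℝ u v‖ * jap v :=
      ((fderiv ℝ u v).le_opNorm v).trans (by gcongr; exact norm_le_jap v)
    have k3 : 0 ≤ 1 / 2 * u v ^ 2 + 2 * (‖fderiv ℝ u v‖ * jap v) ^ 2 + 2 * u v * fderiv ℝ u v v := by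
      have : (fderiv ℝ u v v) ^ 2 ≤ (‖fderiv ℝ u v‖ * jap v) ^ 2 := by
        rw [← sq_abs (fderiv ℝ u v v)]
        gcongr
      nlinarith [sq_nonneg (u v + 2 * fderiv ℝ u v v)]
    have k4 := mul_nonneg hJ2.le k3
    have k5 := mul_nonneg (sq_nonneg (u v)) k1
    rw [e2]
    nlinarith
  have hI := integral_mono i1 (((i1.const_mul 3).add i3).add ((i1.const_mul (1/2)).add (i2.const_mul 2))) hpt
  rw [integral_add' ((i1.const_mul 3).add i3) ((i1.const_mul (1/2)).add (i2.const_mul 2)),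
    integral_add' (i1.const_mul 3) i3, integral_add' (i1.const_mul (1/2)) (i2.const_mul 2),
    integral_const_mul, integral_const_mul, integral_const_mul, he] at hI
  linarith

lemma sobolev : ∃ K : ℝ, 0 ≤ K ∧ ∀ u : V3 → ℝ, ContDiff ℝ 1 u → HasCompactSupport u →
    ∫ v, u v ^ 6 ≤ K * (∫ v, ‖fderiv ℝ u v‖ ^ 2) ^ 3 := by
  let K : NNReal := eLpNormLESNormFDerivOfEqInnerConst (volume : Measure V3) 2
  refine ⟨(K : ℝ) ^ 6, by positivity, fun u hu hc => ?_⟩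
  have h := eLpNorm_le_eLpNorm_fderiv_of_eq_inner (volume : Measure V3) hu hc (p := 2) (p' := 6)
    (by norm_num) (by simp) (by simp; norm_num)
  have hdc : Continuous (fderiv ℝ u) := hu.continuous_fderiv one_ne_zero
  have m1 : MemLp u ((6 : NNReal) : ENNReal) := hu.continuous.memLp_of_hasCompactSupport hc
  have m2 : MemLp (fderiv ℝ u) ((2 : NNReal) : ENNReal) := hdc.memLp_of_hasCompactSupport (hc.fderiv (𝕜 := ℝ))
  rw [m1.eLpNorm_eq_integral_rpow_norm (by simp) (by simp),
    m2.eLpNorm_eq_integral_rpow_norm (by simp) (by simp)] at h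
  change _ ≤ (K : ENNReal) * _ at h
  rw [← ENNReal.ofReal_coe_nnreal (p := K), ← ENNReal.ofReal_mul K.coe_nonneg] at h
  simp only [ENNReal.coe_toReal, NNReal.coe_ofNat] at h
  have hA : 0 ≤ ∫ v, ‖u v‖ ^ (6 : ℝ) := by positivity
  have hB : 0 ≤ ∫ v, ‖fderiv ℝ u v‖ ^ (2 : ℝ) := by positivity
  rw [ENNReal.ofReal_le_ofReal_iff (by positivity)] at h
  have h6 := pow_le_pow_left₀ (by positivity) h 6
  rw [mul_pow, ← Real.rpow_mul_natCast hA, ← Real.rpow_mul_natCast hB] at h6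
  norm_num at h6
  have e : ∀ x : ℝ, |x| ^ 6 = x ^ 6 := fun x => by
    rw [show 6 = 2 * 3 by norm_num, pow_mul, pow_mul, sq_abs]
  simpa [e] using h6

lemma weighted_sobolev_cpt (a : ℝ) (ha : 0 ≤ a) : ∃ K : ℝ, 0 ≤ K ∧ ∀ u : V3 → ℝ, ContDiff ℝ 1 u →
    HasCompactSupport u →
    ∫ v, jap v ^ (3 * a) * u v ^ 6 ≤ K * (∫ v, jap v ^ a * ‖fderiv ℝ u v‖ ^ 2) ^ 3 := by
  obtain ⟨K, hK, hS⟩ := sobolev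
  refine ⟨K * (2 + 2 * a ^ 2) ^ 3, by positivity, fun u hu hc => ?_⟩
  have hdc : Continuous (fderiv ℝ u) := hu.continuous_fderiv one_ne_zero
  have hw : ContDiff ℝ 1 (fun v => jap v ^ (a / 2) * u v) := (contDiff_jap_rpow _).mul hu
  have hwc : HasCompactSupport (fun v => jap v ^ (a / 2) * u v) := hc.mul_left
  have h1 := hS _ hw hwc
  have e1 : ∀ v, (jap v ^ (a / 2) * u v) ^ 6 = jap v ^ (3 * a) * u v ^ 6 := fun v => by
    rw [mul_pow, ← Real.rpow_mul_natCast (jap_pos v).le]; congr 2; push_cast; ring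
  simp_rw [e1] at h1
  have hc2 : HasCompactSupport (fun v => u v ^ 2) := by
    simp_rw [pow_two]; exact hc.mul_left
  have hcd : HasCompactSupport (fun v => ‖fderiv ℝ u v‖ ^ 2) :=
    (hc.fderiv (𝕜 := ℝ)).comp_left (g := fun L => ‖L‖ ^ 2) (by simp)
  have hwcd : HasCompactSupport (fun v => ‖fderiv ℝ (fun v => jap v ^ (a / 2) * u v) v‖ ^ 2) :=
    (hwc.fderiv (𝕜 := ℝ)).comp_left (g := fun L => ‖L‖ ^ 2) (by simp)
  have i1 : Integrable (fun v => jap v ^ (a - 2) * u v ^ 2) :=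
    ((continuous_jap_rpow _).mul (hu.continuous.pow 2)).integrable_of_hasCompactSupport hc2.mul_left
  have i2 : Integrable (fun v => jap v ^ a * ‖fderiv ℝ u v‖ ^ 2) :=
    ((continuous_jap_rpow a).mul (hdc.norm.pow 2)).integrable_of_hasCompactSupport hcd.mul_left
  have i3 : Integrable (fun v => ‖fderiv ℝ (fun v => jap v ^ (a / 2) * u v) v‖ ^ 2) :=
    ((hw.continuous_fderiv one_ne_zero).norm.pow 2).integrable_of_hasCompactSupport hwcd
  have hpt : ∀ v, ‖fderiv ℝ (fun v => jap v ^ (a / 2) * u v) v‖ ^ 2 ≤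
      2 * (jap v ^ a * ‖fderiv ℝ u v‖ ^ 2) + a ^ 2 / 2 * (jap v ^ (a - 2) * u v ^ 2) := by
    intro v
    have hj := jap_pos v
    have hd := (hasFDerivAt_jap_rpow (a / 2) v).mul (hu.differentiable one_ne_zero v).hasFDerivAt
    have hd2 : fderiv ℝ (fun v => jap v ^ (a / 2) * u v) v = _ := HasFDerivAt.fderiv hd
    rw [hd2]
    have n1 : ‖jap v ^ (a / 2) • fderiv ℝ u v‖ = jap v ^ (a / 2) * ‖fderiv ℝ u v‖ := by
      rw [norm_smul, Real.norm_eq_abs, abs_of_pos (jap_rpow_pos _ _)]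
    have n2 : ‖u v • ((a / 2 * jap v ^ (a / 2 - 2)) • innerSL ℝ v)‖ ≤
        |u v| * (a / 2 * jap v ^ (a / 2 - 1)) := by
      have hJ := jap_rpow_pos v (a / 2 - 2)
      rw [norm_smul, norm_smul, innerSL_apply_norm, Real.norm_eq_abs, Real.norm_eq_abs,
        abs_of_nonneg (a := a / 2 * _) (by positivity)]
      have : jap v ^ (a / 2 - 1) = jap v ^ (a / 2 - 2) * jap v := by
        rw [← Real.rpow_add_one hj.ne']; congr 1; ring
      rw [this, ← mul_assoc (a / 2)]
      gcongr
      exact norm_le_jap v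
    have q1 : jap v ^ a = (jap v ^ (a / 2)) ^ 2 := by
      rw [← Real.rpow_mul_natCast hj.le]; congr 1; push_cast; ring
    have q2 : jap v ^ (a - 2) = (jap v ^ (a / 2 - 1)) ^ 2 := by
      rw [← Real.rpow_mul_natCast hj.le]; congr 1; push_cast; ring
    have n3 := (norm_add_le (jap v ^ (a / 2) • fderiv ℝ u v)
      (u v • ((a / 2 * jap v ^ (a / 2 - 2)) • innerSL ℝ v))).trans (add_le_add n1.le n2)
    rw [q1, q2, ← sq_abs (u v)]
    refine (pow_le_pow_left₀ (norm_nonneg _) n3 2).trans ?_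
    nlinarith [sq_nonneg (jap v ^ (a / 2) * ‖fderiv ℝ u v‖ - |u v| * (a / 2 * jap v ^ (a / 2 - 1)))]
  have hI := integral_mono i3 ((i2.const_mul 2).add (i1.const_mul (a ^ 2 / 2))) hpt
  simp only [Pi.add_apply] at hI
  rw [integral_add (i2.const_mul 2) (i1.const_mul (a ^ 2 / 2)), integral_const_mul, integral_const_mul] at hI
  have hH := hardy a ha u hu hc
  have hfin : ∫ v, ‖fderiv ℝ (fun v => jap v ^ (a / 2) * u v) v‖ ^ 2 ≤
      (2 + 2 * a ^ 2) * ∫ v, jap v ^ a * ‖fderiv ℝ u v‖ ^ 2 := by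
    nlinarith [sq_nonneg a]
  calc _ ≤ _ := h1
    _ ≤ K * ((2 + 2 * a ^ 2) * ∫ v, jap v ^ a * ‖fderiv ℝ u v‖ ^ 2) ^ 3 := by
      gcongr
    _ = _ := by ring

/-- cut-off functions -/
lemma exists_cutoff : ∃ (χ : V3 → ℝ) (B : ℝ), 0 ≤ B ∧ ContDiff ℝ 1 χ ∧ HasCompactSupport χ ∧
    (∀ v, 0 ≤ χ v) ∧ (∀ v, χ v ≤ 1) ∧ χ 0 = 1 ∧ ∀ v, ‖fderiv ℝ χ v‖ ≤ B := by
  let b : ContDiffBump (0 : V3) := ⟨1, 2, one_pos, one_lt_two⟩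
  have hd : ContDiff ℝ 1 b := b.contDiff
  obtain ⟨B, hB⟩ := (hd.continuous_fderiv one_ne_zero).bounded_above_of_compact_support
    (b.hasCompactSupport.fderiv (𝕜 := ℝ))
  refine ⟨b, B, (norm_nonneg _).trans (hB 0), hd, b.hasCompactSupport, fun v => b.nonneg,
    fun v => b.le_one, b.one_of_mem_closedBall (by simp [b]), hB⟩

lemma weighted_sobolev (a : ℝ) (ha : 0 ≤ a) : ∃ K : ℝ, 0 ≤ K ∧ ∀ g : V3 → ℝ, ContDiff ℝ 1 g →
    Integrable (fun v => jap v ^ a * ‖fderiv ℝ g v‖ ^ 2) →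
    Integrable (fun v => jap v ^ a * g v ^ 2) →
    Integrable (fun v => jap v ^ (3 * a) * g v ^ 6) →
    ∫ v, jap v ^ (3 * a) * g v ^ 6 ≤ K * (∫ v, jap v ^ a * ‖fderiv ℝ g v‖ ^ 2) ^ 3 := by
  obtain ⟨K, hK, hS⟩ := weighted_sobolev_cpt a ha
  obtain ⟨χ, B, hB, hχ, hχc, hχ0, hχ1, hχz, hχd⟩ := exists_cutoff
  refine ⟨K * 2 ^ 3, by positivity, fun g hg i1 i2 i3 => ?_⟩
  let c : ℕ → ℝ := fun n => ((n : ℝ) + 1)⁻¹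
  have hcpos : ∀ n, 0 < c n := fun n => by positivity
  have hc0 : Filter.Tendsto c Filter.atTop (nhds 0) := by
    simpa [c, one_div] using tendsto_one_div_add_atTop_nhds_zero_nat (𝕜 := ℝ)
  let ψ : ℕ → V3 → ℝ := fun n v => χ (c n • v)
  have hψ : ∀ n, ContDiff ℝ 1 (ψ n) := fun n => hχ.comp (contDiff_const_smul (c n))
  have hψc : ∀ n, HasCompactSupport (ψ n) := fun n => hχc.comp_smul (hcpos n).ne'
  have hψd : ∀ n v, ‖fderiv ℝ (ψ n) v‖ ≤ c n * B := by
    intro n v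
    have h1 : HasFDerivAt (ψ n) ((fderiv ℝ χ (c n • v)).comp (c n • ContinuousLinearMap.id ℝ V3)) v :=
      (hχ.differentiable one_ne_zero (c n • v)).hasFDerivAt.comp v
        ((hasFDerivAt_id v).const_smul (c n))
    rw [h1.fderiv, ContinuousLinearMap.comp_smul, ContinuousLinearMap.comp_id, norm_smul, Real.norm_eq_abs,
      abs_of_pos (hcpos n)]
    have := hcpos n
    gcongr
    exact hχd _
  have hmain : ∀ n, ∫ v, jap v ^ (3 * a) * (ψ n v * g v) ^ 6 ≤
      K * (2 * (∫ v, jap v ^ a * ‖fderiv ℝ g v‖ ^ 2) + 2 * (c n * B) ^ 2 * ∫ v, jap v ^ a * g v ^ 2) ^ 3 := by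
    intro n
    have hu : ContDiff ℝ 1 (fun v => ψ n v * g v) := (hψ n).mul hg
    have huc : HasCompactSupport (fun v => ψ n v * g v) := (hψc n).mul_right
    refine (hS _ hu huc).trans ?_
    have hcd : HasCompactSupport (fun v => ‖fderiv ℝ (fun v => ψ n v * g v) v‖ ^ 2) :=
      (huc.fderiv (𝕜 := ℝ)).comp_left (g := fun L => ‖L‖ ^ 2) (by simp)
    have j1 : Integrable (fun v => jap v ^ a * ‖fderiv ℝ (fun v => ψ n v * g v) v‖ ^ 2) :=
      ((continuous_jap_rpow a).mul
        ((hu.continuous_fderiv one_ne_zero).norm.pow 2)).integrable_of_hasCompactSupport hcd.mul_left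
    have hpt : ∀ v, jap v ^ a * ‖fderiv ℝ (fun v => ψ n v * g v) v‖ ^ 2 ≤
        2 * (jap v ^ a * ‖fderiv ℝ g v‖ ^ 2) + 2 * (c n * B) ^ 2 * (jap v ^ a * g v ^ 2) := by
      intro v
      have hJ := jap_rpow_pos v a
      have hd := ((hψ n).differentiable one_ne_zero v).hasFDerivAt.mul
        (hg.differentiable one_ne_zero v).hasFDerivAt
      have hd2 : fderiv ℝ (fun v => ψ n v * g v) v = _ := HasFDerivAt.fderiv hd
      rw [hd2]
      have n1 : ‖ψ n v • fderiv ℝ g v‖ ≤ ‖fderiv ℝ g v‖ := by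
        rw [norm_smul, Real.norm_eq_abs, abs_of_nonneg (hχ0 _)]
        exact mul_le_of_le_one_left (norm_nonneg _) (hχ1 _)
      have n2 : ‖g v • fderiv ℝ (ψ n) v‖ ≤ |g v| * (c n * B) := by
        rw [norm_smul, Real.norm_eq_abs]
        gcongr
        exact hψd n v
      have n3 := (norm_add_le (ψ n v • fderiv ℝ g v) (g v • fderiv ℝ (ψ n) v)).trans (add_le_add n1 n2)
      have n4 : ‖ψ n v • fderiv ℝ g v + g v • fderiv ℝ (ψ n) v‖ ^ 2 ≤
          2 * ‖fderiv ℝ g v‖ ^ 2 + 2 * (c n * B) ^ 2 * g v ^ 2 := by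
        refine (pow_le_pow_left₀ (norm_nonneg _) n3 2).trans ?_
        rw [← sq_abs (g v)]
        nlinarith [sq_nonneg (‖fderiv ℝ g v‖ - |g v| * (c n * B))]
      have := mul_le_mul_of_nonneg_left n4 hJ.le
      linarith
    have hI := integral_mono j1 ((i1.const_mul 2).add (i2.const_mul (2 * (c n * B) ^ 2))) hpt
    simp only [Pi.add_apply] at hI
    rw [integral_add (i1.const_mul 2) (i2.const_mul _), integral_const_mul, integral_const_mul] at hI
    have h0 : 0 ≤ ∫ v, jap v ^ a * ‖fderiv ℝ (fun v => ψ n v * g v) v‖ ^ 2 :=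
      integral_nonneg fun v => mul_nonneg (jap_rpow_pos v a).le (by positivity)
    gcongr
  have l1 : Filter.Tendsto (fun n => ∫ v, jap v ^ (3 * a) * (ψ n v * g v) ^ 6) Filter.atTop
      (nhds (∫ v, jap v ^ (3 * a) * g v ^ 6)) := by
    refine tendsto_integral_of_dominated_convergence _ (fun n => ?_) i3 (fun n => ?_) ?_
    · exact ((continuous_jap_rpow _).mul (((hψ n).continuous.mul hg.continuous).pow 6)).aestronglyMeasurable
    · refine ae_of_all _ fun v => ?_
      have hJ := jap_rpow_pos v (3 * a)
      have hn : 0 ≤ ψ n v := hχ0 _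
      have hg6 : 0 ≤ g v ^ 6 := by positivity
      rw [Real.norm_eq_abs, abs_of_nonneg (by positivity), mul_pow]
      gcongr
      exact mul_le_of_le_one_left hg6 (pow_le_one₀ hn (hχ1 _))
    · refine ae_of_all _ fun v => ?_
      have t1 : Filter.Tendsto (fun n => ψ n v) Filter.atTop (nhds 1) := by
        have := (hχ.continuous.tendsto 0).comp (f := fun n => c n • v) (x := Filter.atTop)
          (by simpa using hc0.smul_const v)
        rwa [hχz] at this
      simpa using ((t1.mul_const (g v)).pow 6).const_mul (jap v ^ (3 * a))
  have l2 : Filter.Tendsto (fun n => K * (2 * (∫ v, jap v ^ a * ‖fderiv ℝ g v‖ ^ 2) +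
      2 * (c n * B) ^ 2 * ∫ v, jap v ^ a * g v ^ 2) ^ 3) Filter.atTop
      (nhds (K * (2 * (∫ v, jap v ^ a * ‖fderiv ℝ g v‖ ^ 2) +
      2 * (0 * B) ^ 2 * ∫ v, jap v ^ a * g v ^ 2) ^ 3)) :=
    (((((hc0.mul_const B).pow 2).const_mul 2).mul_const _).const_add _ |>.pow 3).const_mul K
  refine (le_of_tendsto_of_tendsto' l1 l2 hmain).trans (le_of_eq ?_)
  ring

end WII

/-- weighted interpolation inequality, with
`m = (2kp − (k−3)(3q−3p))/(3p−q)`. -/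
theorem weighted_interpolation_inequality
    (p q k : ℝ) (hp : 1 < p) (hpq : p < q) (hq3p : q < 3 * p) (hk : 3 ≤ k) :
    ∃ C : ℝ, 0 < C ∧
      ∀ f : SchwartzMap V3 ℝ, (∀ v, 0 ≤ f v) →
        (∫ v : V3, jap v ^ k * f v ^ q) ≤
          C * (∫ v : V3, jap v ^ ((2 * k * p - (k - 3) * (3 * q - 3 * p)) / (3 * p - q)) *
                f v ^ p) ^ ((3 * p - q) / (2 * p)) *
            (∫ v : V3, jap v ^ (k - 3) *
                ‖gradient (fun u => f u ^ (p / 2)) v‖ ^ 2) ^ (3 * (q - p) / (2 * p)) := by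
  obtain ⟨K, hK, hS⟩ := WII.weighted_sobolev (k - 3) (by linarith)
  set θ : ℝ := (3 * p - q) / (2 * p) with hθ
  set τ : ℝ := (q - p) / (2 * p) with hτ
  have hp0 : 0 < p := by linarith
  have hθ0 : 0 < θ := div_pos (by linarith) (by linarith)
  have hτ0 : 0 < τ := div_pos (by linarith) (by linarith)
  have hsum : θ + τ = 1 := by rw [hθ, hτ]; field_simp; ring
  refine ⟨(K + 1) ^ τ, by positivity, fun f hf => ?_⟩
  set m : ℝ := (2 * k * p - (k - 3) * (3 * q - 3 * p)) / (3 * p - q) with hm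
  have hs : 1 / 2 < p / 2 := by linarith
  have hgrad : ∀ v, ‖gradient (fun u => f u ^ (p / 2)) v‖ = ‖fderiv ℝ (fun u => f u ^ (p / 2)) v‖ := by
    intro v
    unfold gradient
    exact LinearIsometryEquiv.norm_map _ _
  simp_rw [hgrad]
  have e2 : ∀ v, (f v ^ (p / 2)) ^ 2 = f v ^ p := fun v => by
    rw [← Real.rpow_mul_natCast (hf v)]; congr 1; push_cast; ring
  have e6 : ∀ v, (f v ^ (p / 2)) ^ 6 = f v ^ (3 * p) := fun v => by
    rw [← Real.rpow_mul_natCast (hf v)]; congr 1; push_cast; ring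
  have iP := WII.integrable_jap_schwartz f hf p m hp0
  have i6 := WII.integrable_jap_schwartz f hf (3 * p) (3 * (k - 3)) (by linarith)
  have hSob := hS (fun u => f u ^ (p / 2)) (WII.contDiff_rpow f hf _ hs)
    (WII.integrable_grad f hf _ _ hs)
    (by simp_rw [e2]; exact WII.integrable_jap_schwartz f hf _ _ hp0) (by simp_rw [e6]; exact i6)
  simp_rw [e6] at hSob
  set G := ∫ v : V3, jap v ^ (k - 3) * ‖fderiv ℝ (fun u => f u ^ (p / 2)) v‖ ^ 2 with hG
  have hG0 : 0 ≤ G := integral_nonneg fun v => mul_nonneg (WII.jap_rpow_pos v _).le (by positivity)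
  have hA0 : ∀ v, 0 ≤ jap v ^ m * f v ^ p := fun v =>
    mul_nonneg (WII.jap_rpow_pos v _).le (Real.rpow_nonneg (hf v) _)
  have hB0 : ∀ v, 0 ≤ jap v ^ (3 * (k - 3)) * f v ^ (3 * p) := fun v =>
    mul_nonneg (WII.jap_rpow_pos v _).le (Real.rpow_nonneg (hf v) _)
  have hprod : ∀ v, jap v ^ k * f v ^ q =
      (jap v ^ m * f v ^ p) ^ θ * (jap v ^ (3 * (k - 3)) * f v ^ (3 * p)) ^ τ := by
    intro v
    have hj := WII.jap_pos v
    rw [Real.mul_rpow (WII.jap_rpow_pos v _).le (Real.rpow_nonneg (hf v) _),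
      Real.mul_rpow (WII.jap_rpow_pos v _).le (Real.rpow_nonneg (hf v) _),
      ← Real.rpow_mul hj.le, ← Real.rpow_mul hj.le, ← Real.rpow_mul (hf v), ← Real.rpow_mul (hf v)]
    have ek : k = m * θ + 3 * (k - 3) * τ := by
      have : 3 * p - q ≠ 0 := by linarith
      have hmθ : m * θ = (2 * k * p - (k - 3) * (3 * q - 3 * p)) / (2 * p) := by
        rw [hm, hθ, div_mul_div_comm, mul_comm (3 * p - q), mul_div_mul_right _ _ this]
      rw [hmθ, hτ]; field_simp; ring
    have eq : q = p * θ + 3 * p * τ := by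
      rw [hθ, hτ]; field_simp; ring
    have z1 : jap v ^ k = jap v ^ (m * θ) * jap v ^ (3 * (k - 3) * τ) := by
      rw [← Real.rpow_add hj, ← ek]
    have z2 : f v ^ q = f v ^ (p * θ) * f v ^ (3 * p * τ) := by
      rw [← Real.rpow_add_of_nonneg (hf v) (by positivity) (by positivity), ← eq]
    rw [z1, z2]; ring
  simp_rw [hprod]
  have hconj : (1 / θ).HolderConjugate (1 / τ) := by
    rw [Real.holderConjugate_iff]
    refine ⟨?_, by simpa using hsum⟩
    rw [lt_div_iff₀ hθ0]; linarith
  have aux : ∀ (F : V3 → ℝ) (t : ℝ), 0 < t → (∀ v, 0 ≤ F v) → Integrable F →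
      MemLp (fun v => F v ^ t) (ENNReal.ofReal (1 / t)) := by
    intro F t ht hF hI
    have hpos : 0 < 1 / t := by positivity
    rw [← integrable_norm_rpow_iff (hI.aestronglyMeasurable.aemeasurable.pow_const t).aestronglyMeasurable
      (by simpa using ht) (by simp)]
    refine hI.congr (ae_of_all _ fun v => ?_)
    simp only
    rw [ENNReal.toReal_ofReal hpos.le, Real.norm_eq_abs, abs_of_nonneg (Real.rpow_nonneg (hF v) _),
      ← Real.rpow_mul (hF v), mul_one_div_cancel ht.ne', Real.rpow_one]
  have hH := integral_mul_le_Lp_mul_Lq_of_nonneg (μ := (volume : Measure V3)) hconj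
    (f := fun v => (jap v ^ m * f v ^ p) ^ θ)
    (g := fun v => (jap v ^ (3 * (k - 3)) * f v ^ (3 * p)) ^ τ)
    (ae_of_all _ fun v => Real.rpow_nonneg (hA0 v) _) (ae_of_all _ fun v => Real.rpow_nonneg (hB0 v) _)
    (aux _ θ hθ0 hA0 iP) (aux _ τ hτ0 hB0 i6)
  simp_rw [← Real.rpow_mul (hA0 _), ← Real.rpow_mul (hB0 _), mul_one_div_cancel hθ0.ne',
    mul_one_div_cancel hτ0.ne', Real.rpow_one, one_div_one_div] at hH
  refine hH.trans ?_
  have hI0 : 0 ≤ ∫ v : V3, jap v ^ m * f v ^ p := integral_nonneg hA0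
  have hJ0 : 0 ≤ ∫ v : V3, jap v ^ (3 * (k - 3)) * f v ^ (3 * p) := integral_nonneg hB0
  have hfin : (∫ v : V3, jap v ^ (3 * (k - 3)) * f v ^ (3 * p)) ^ τ ≤
      (K + 1) ^ τ * G ^ (3 * (q - p) / (2 * p)) := by
    calc _ ≤ ((K + 1) * G ^ 3) ^ τ := by
          apply Real.rpow_le_rpow hJ0 _ hτ0.le
          refine hSob.trans ?_
          gcongr
          linarith
      _ = _ := by
          rw [Real.mul_rpow (by positivity) (by positivity), ← Real.rpow_natCast,
            ← Real.rpow_mul hG0]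
          congr 2
          rw [hτ]; push_cast; ring
  calc _ ≤ (∫ v : V3, jap v ^ m * f v ^ p) ^ θ * ((K + 1) ^ τ * G ^ (3 * (q - p) / (2 * p))) := by
        gcongr
    _ = _ := by ring
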